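/- Let $n, N \ge 1$, $1 < p < q_0 < q < q_1 < \infty$, $C > 0$, and let $\alpha \in \mathbb{C}$ with $\Re\alpha = \frac{n}{p} - \frac{n}{q}$. Let $u : (0,\infty) \times \mathbb{R}^n \to \mathbb{C}^N$ be measurable with $\|u(t,\cdot)\|_{L^{q_i}} \le C\, t^{\frac{n}{q_i} - \frac{n}{p}}$ for $i = 0, 1$ and all $t > 0$. Let $0 < \epsilon < R < \infty$. Then for almost every $x \in \mathbb{R}^n$ the integral $F(x) := \int_\epsilon^R t^{\alpha - 1} u(t, x)\, dt$ converges absolutely, and there is a constant $C'$ depending only on $n, p, q, q_0, q_1, C$ (in particular independent of $\epsilon, R$ and $u$) such that for all $\lambda > 0$: $\left| \{ x \in \mathbb{R}^n : |F(x)| > \lambda \} \right| \le C' \lambda^{-q}$. -/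

import Mathlib

open MeasureTheory ENNReal

section WeakType

variable {X : Type*} [MeasurableSpace X] {μ : Measure X}

/-- Jensen's inequality for a measure of arbitrary total mass. -/
lemma lintegral_rpow_le_measure_univ_rpow_mul {T : Type*} [MeasurableSpace T] {ν : Measure T}
    {r : ℝ} (hr : 1 ≤ r) {f : T → ℝ≥0∞} (hf : Measurable f) :
    (∫⁻ t, f t ∂ν) ^ r ≤ ν Set.univ ^ (r - 1) * ∫⁻ t, f t ^ r ∂ν := by
  have hr0 : 0 < r := by linarith
  have h := eLpNorm'_le_eLpNorm'_mul_rpow_measure_univ (μ := ν) one_pos hr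
    hf.aestronglyMeasurable
  simp only [eLpNorm'_eq_lintegral_enorm, enorm_eq_self, ENNReal.rpow_one, div_one] at h
  calc (∫⁻ t, f t ∂ν) ^ r
      ≤ ((∫⁻ t, f t ^ r ∂ν) ^ (1 / r) * ν Set.univ ^ (1 - 1 / r)) ^ r :=
        ENNReal.rpow_le_rpow h hr0.le
    _ = ν Set.univ ^ (r - 1) * ∫⁻ t, f t ^ r ∂ν := by
        rw [ENNReal.mul_rpow_of_nonneg _ _ hr0.le, ← ENNReal.rpow_mul, ← ENNReal.rpow_mul,
          mul_comm, one_div_mul_cancel hr0.ne', ENNReal.rpow_one, sub_mul,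
          one_div_mul_cancel hr0.ne', one_mul]

/-- Minkowski's integral inequality for a family that is uniformly bounded in `L^r`. -/
lemma lintegral_lintegral_rpow_le [SFinite μ] {T : Type*} [MeasurableSpace T] {ν : Measure T}
    [SFinite ν] {r : ℝ} (hr : 1 ≤ r) {f : T → X → ℝ≥0∞} (hf : Measurable (Function.uncurry f))
    {B : ℝ≥0∞} (hB : ∀ᵐ t ∂ν, ∫⁻ x, f t x ^ r ∂μ ≤ B ^ r) :
    ∫⁻ x, (∫⁻ t, f t x ∂ν) ^ r ∂μ ≤ (ν Set.univ * B) ^ r := by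
  have hr0 : 0 < r := by linarith
  have hfr : Measurable (Function.uncurry fun x t => f t x ^ r) :=
    (hf.comp measurable_swap).pow_const r
  calc ∫⁻ x, (∫⁻ t, f t x ∂ν) ^ r ∂μ
      ≤ ∫⁻ x, ν Set.univ ^ (r - 1) * ∫⁻ t, f t x ^ r ∂ν ∂μ :=
        lintegral_mono fun x => lintegral_rpow_le_measure_univ_rpow_mul hr hf.of_uncurry_right
    _ = ν Set.univ ^ (r - 1) * ∫⁻ t, ∫⁻ x, f t x ^ r ∂μ ∂ν := by
        rw [lintegral_const_mul _ hfr.lintegral_prod_right, lintegral_lintegral_swap hfr.aemeasurable]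
    _ ≤ ν Set.univ ^ (r - 1) * ∫⁻ _, B ^ r ∂ν :=
        mul_le_mul_right (lintegral_mono_ae hB) _
    _ = (ν Set.univ * B) ^ r := by
        rw [lintegral_const, ENNReal.mul_rpow_of_nonneg _ _ hr0.le, mul_comm (B ^ r), ← mul_assoc]
        congr 1
        nth_rw 2 [← ENNReal.rpow_one (ν Set.univ)]
        rw [← ENNReal.rpow_add_of_nonneg _ _ (by linarith) zero_le_one, sub_add_cancel]

variable {E : Type*} [NormedAddCommGroup E]

lemma lintegral_setLIntegral_rpow_le [SFinite μ] {r C d e : ℝ} (hr : 1 ≤ r)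
    {u : ℝ → X → E} (hu : StronglyMeasurable (Function.uncurry u))
    (hbound : ∀ t, 0 < t → eLpNorm (u t) (ENNReal.ofReal r) μ ≤ ENNReal.ofReal (C * t ^ (-e)))
    {S : Set ℝ} (hS : MeasurableSet S) (hS0 : S ⊆ Set.Ioi 0) :
    ∫⁻ x, (∫⁻ t in S, ENNReal.ofReal (t ^ (d + e - 1)) * ‖u t x‖ₑ) ^ r ∂μ ≤
      ((∫⁻ t in S, ENNReal.ofReal (t ^ (d - 1))) * ENNReal.ofReal C) ^ r := by
  have hr0 : 0 < r := by linarith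
  have hw : Measurable fun t : ℝ => ENNReal.ofReal (t ^ (d - 1)) := by fun_prop
  have hf : Measurable (Function.uncurry fun t x => ENNReal.ofReal (t ^ e) * ‖u t x‖ₑ) :=
    (Measurable.ennreal_ofReal (measurable_fst.pow_const e)).mul hu.enorm
  have hpos : ∀ᵐ t ∂(volume.restrict S), 0 < t :=
    (ae_restrict_mem hS).mono fun t ht => hS0 ht
  have hB : ∀ᵐ t ∂((volume.restrict S).withDensity fun t => ENNReal.ofReal (t ^ (d - 1))),
      ∫⁻ x, (ENNReal.ofReal (t ^ e) * ‖u t x‖ₑ) ^ r ∂μ ≤ ENNReal.ofReal C ^ r := by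
    filter_upwards [withDensity_absolutelyContinuous _ _ hpos] with t ht
    have hm : Measurable fun x => ‖u t x‖ₑ ^ r :=
      (hu.comp_measurable measurable_prodMk_left).enorm.pow_const r
    have h := hbound t ht
    rw [eLpNorm_eq_lintegral_rpow_enorm_toReal (by simpa using hr0) ENNReal.ofReal_ne_top,
      ENNReal.toReal_ofReal hr0.le, one_div, ENNReal.rpow_inv_le_iff hr0] at h
    simp_rw [ENNReal.mul_rpow_of_nonneg _ _ hr0.le]
    rw [lintegral_const_mul _ hm]
    refine (mul_le_mul_right h _).trans_eq ?_
    rw [← ENNReal.mul_rpow_of_nonneg _ _ hr0.le, ← ENNReal.ofReal_mul (by positivity),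
      mul_left_comm, ← Real.rpow_add ht, add_neg_cancel, Real.rpow_zero, mul_one]
  have h := lintegral_lintegral_rpow_le hr hf hB
  rw [withDensity_apply _ MeasurableSet.univ, Measure.restrict_univ] at h
  convert h using 4 with x
  rw [lintegral_withDensity_eq_lintegral_mul _ hw hf.of_uncurry_right]
  refine lintegral_congr_ae (hpos.mono fun t ht => ?_)
  simp only [Pi.mul_apply]
  rw [← mul_assoc, ← ENNReal.ofReal_mul (by positivity), ← Real.rpow_add ht]
  congr 3
  ring

lemma setLIntegral_Ioc_rpow_sub_one {τ d : ℝ} (hτ : 0 < τ) (hd : 0 < d) :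
    ∫⁻ t in Set.Ioc 0 τ, ENNReal.ofReal (t ^ (d - 1)) = ENNReal.ofReal (τ ^ d / d) := by
  have hint : IntegrableOn (fun t : ℝ => t ^ (d - 1)) (Set.Ioc 0 τ) :=
    (intervalIntegrable_iff_integrableOn_Ioc_of_le hτ.le).1
      (intervalIntegral.intervalIntegrable_rpow' (by linarith))
  rw [← ofReal_integral_eq_lintegral_ofReal hint
      ((ae_restrict_mem measurableSet_Ioc).mono fun t ht => Real.rpow_nonneg ht.1.le _),
    ← intervalIntegral.integral_of_le hτ.le, integral_rpow (Or.inl (by linarith)),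
    sub_add_cancel, Real.zero_rpow hd.ne', sub_zero]

lemma setLIntegral_Ioi_rpow_sub_one {τ d : ℝ} (hτ : 0 < τ) (hd : d < 0) :
    ∫⁻ t in Set.Ioi τ, ENNReal.ofReal (t ^ (d - 1)) = ENNReal.ofReal (τ ^ d / -d) := by
  rw [← ofReal_integral_eq_lintegral_ofReal (integrableOn_Ioi_rpow_of_lt (by linarith) hτ)
      ((ae_restrict_mem measurableSet_Ioi).mono fun t ht => Real.rpow_nonneg (hτ.trans ht).le _),
    integral_Ioi_rpow_of_lt (by linarith) hτ, sub_add_cancel, neg_div, div_neg]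

lemma measurable_setLIntegral_rpow_mul_enorm {u : ℝ → X → E}
    (hu : StronglyMeasurable (Function.uncurry u)) (s : ℝ) (S : Set ℝ) :
    Measurable fun x => ∫⁻ t in S, ENNReal.ofReal (t ^ s) * ‖u t x‖ₑ :=
  Measurable.lintegral_prod_left
    ((Measurable.ennreal_ofReal (measurable_fst.pow_const s)).mul hu.enorm)

/-- The choice `τ = lam ^ (-q / m)` balances the two pieces of the fractional integral: each
obeys the weak type bound with the same power `lam ^ (-q)`. -/
lemma measure_setLIntegral_ge_le [SFinite μ] {r C d e m q lam : ℝ} (hr : 1 ≤ r)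
    (hC : 0 < C) (hq : 0 < q) (hm : 0 < m) (hd0 : d ≠ 0) (hd : d = m / r - m / q)
    {u : ℝ → X → E} (hu : StronglyMeasurable (Function.uncurry u))
    (hbound : ∀ t, 0 < t → eLpNorm (u t) (ENNReal.ofReal r) μ ≤ ENNReal.ofReal (C * t ^ (-e)))
    {S : Set ℝ} (hS : MeasurableSet S) (hS0 : S ⊆ Set.Ioi 0) (hlam : 0 < lam)
    (hSint : ∫⁻ t in S, ENNReal.ofReal (t ^ (d - 1)) =
      ENNReal.ofReal ((lam ^ (-q / m)) ^ d / |d|)) :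
    μ {x | ENNReal.ofReal (lam / 2) ≤
        ∫⁻ t in S, ENNReal.ofReal (t ^ (d + e - 1)) * ‖u t x‖ₑ} ≤
      ENNReal.ofReal ((2 * C / |d|) ^ r * lam ^ (-q)) := by
  have hr0 : 0 < r := by linarith
  have hd' : 0 < |d| := abs_pos.2 hd0
  have hG := (measurable_setLIntegral_rpow_mul_enorm hu (d + e - 1) S).pow_const r
  have hint := lintegral_setLIntegral_rpow_le (d := d) hr hu hbound hS hS0
  have hl : ENNReal.ofReal (lam / 2) ^ r = ENNReal.ofReal ((lam / 2) ^ r) :=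
    ENNReal.ofReal_rpow_of_pos (by positivity)
  have hl0 : 0 < (lam / 2) ^ r := by positivity
  calc μ {x | ENNReal.ofReal (lam / 2) ≤
        ∫⁻ t in S, ENNReal.ofReal (t ^ (d + e - 1)) * ‖u t x‖ₑ}
      = μ {x | ENNReal.ofReal ((lam / 2) ^ r) ≤
        (∫⁻ t in S, ENNReal.ofReal (t ^ (d + e - 1)) * ‖u t x‖ₑ) ^ r} := by
        simp_rw [← hl, ENNReal.rpow_le_rpow_iff hr0]
    _ ≤ _ / ENNReal.ofReal ((lam / 2) ^ r) :=
        meas_ge_le_lintegral_div hG.aemeasurable (by simpa using hl0) ENNReal.ofReal_ne_top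
    _ ≤ _ / ENNReal.ofReal ((lam / 2) ^ r) := ENNReal.div_le_div_right hint _
    _ = ENNReal.ofReal ((2 * C / |d|) ^ r * lam ^ (-q)) := by
        rw [hSint, ← ENNReal.ofReal_mul (by positivity),
          ENNReal.ofReal_rpow_of_pos (by positivity), ← ENNReal.ofReal_div_of_pos hl0,
          ← Real.div_rpow (by positivity) (by positivity), ← Real.rpow_mul hlam.le]
        congr 1
        have h1 : lam ^ (-q / m * d) / |d| * C / (lam / 2) =
            2 * C / |d| * lam ^ (-q / m * d - 1) := by
          rw [Real.rpow_sub_one hlam.ne']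
          field_simp
        rw [h1, Real.mul_rpow (by positivity) (by positivity), ← Real.rpow_mul hlam.le]
        congr 2
        rw [hd]
        field_simp
        ring

lemma setLIntegral_enorm_cpow_smul [NormedSpace ℂ E] (α : ℂ) (v : ℝ → E) {S : Set ℝ}
    (hS : MeasurableSet S) (hS0 : S ⊆ Set.Ioi 0) :
    ∫⁻ t in S, ‖((t : ℂ) ^ (α - 1)) • v t‖ₑ =
      ∫⁻ t in S, ENNReal.ofReal (t ^ (α.re - 1)) * ‖v t‖ₑ := by
  refine setLIntegral_congr_fun hS fun t ht => ?_
  rw [enorm_smul, ← ofReal_norm, Complex.norm_cpow_eq_rpow_re_of_pos (hS0 ht), Complex.sub_re,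
    Complex.one_re]

end WeakType

/-- Weak type `(p,q)` estimate, uniform in the truncation, for truncated
fractional integrals of a family `u(t,·)` satisfying `‖u(t,·)‖_{q_i} ≤ C t^{n/q_i - n/p}`
for `i = 0,1`, where `1 < p < q₀ < q < q₁ < ∞` and `Re α = n/p - n/q`. -/
theorem stmt13 (n N : ℕ) (hn : 1 ≤ n) (hN : 1 ≤ N) (p q₀ q q₁ C : ℝ)
    (hp : 1 < p) (hpq₀ : p < q₀) (hq₀q : q₀ < q) (hqq₁ : q < q₁) (hC : 0 < C) :
    ∃ C' : ℝ, 0 < C' ∧ ∀ (α : ℂ), α.re = (n : ℝ) / p - (n : ℝ) / q →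
      ∀ (u : ℝ → EuclideanSpace ℝ (Fin n) → EuclideanSpace ℂ (Fin N)),
      StronglyMeasurable (Function.uncurry u) →
      (∀ t : ℝ, 0 < t →
        eLpNorm (u t) (ENNReal.ofReal q₀) (volume : Measure (EuclideanSpace ℝ (Fin n))) ≤
          ENNReal.ofReal (C * t ^ ((n : ℝ) / q₀ - (n : ℝ) / p))) →
      (∀ t : ℝ, 0 < t →
        eLpNorm (u t) (ENNReal.ofReal q₁) (volume : Measure (EuclideanSpace ℝ (Fin n))) ≤
          ENNReal.ofReal (C * t ^ ((n : ℝ) / q₁ - (n : ℝ) / p))) →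
      ∀ (ε R : ℝ), 0 < ε → ε < R →
        (∀ᵐ x ∂(volume : Measure (EuclideanSpace ℝ (Fin n))),
          IntegrableOn (fun t : ℝ => ((t : ℂ) ^ (α - 1)) • u t x) (Set.Ioc ε R)) ∧
        ∀ lam : ℝ, 0 < lam →
          volume {x : EuclideanSpace ℝ (Fin n) |
              lam < ‖∫ t in Set.Ioc ε R, ((t : ℂ) ^ (α - 1)) • u t x‖} ≤
            ENNReal.ofReal (C' * lam ^ (-q)) := by
  have hn0 : (0 : ℝ) < n := by exact_mod_cast hn
  have hp0 : 0 < p := by linarith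
  have hq₀0 : 0 < q₀ := by linarith
  have hq0 : 0 < q := by linarith
  have hd₀ : 0 < (n : ℝ) / q₀ - n / q := sub_pos.2 (div_lt_div_of_pos_left hn0 hq₀0 hq₀q)
  have hd₁ : (n : ℝ) / q₁ - n / q < 0 := sub_neg.2 (div_lt_div_of_pos_left hn0 hq0 hqq₁)
  refine ⟨(2 * C / |(n : ℝ) / q₀ - n / q|) ^ q₀ + (2 * C / |(n : ℝ) / q₁ - n / q|) ^ q₁, ?_, ?_⟩
  · have := abs_pos.2 hd₀.ne'
    have := abs_pos.2 hd₁.ne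
    positivity
  intro α hα u hu hu₀ hu₁ ε R hε hεR
  have hexp (r : ℝ) : α.re - 1 = ((n : ℝ) / r - n / q) + ((n : ℝ) / p - n / r) - 1 := by
    rw [hα]; ring
  replace hu₀ : ∀ t : ℝ, 0 < t → eLpNorm (u t) (ENNReal.ofReal q₀) volume ≤
      ENNReal.ofReal (C * t ^ (-((n : ℝ) / p - n / q₀))) := by
    simpa only [neg_sub] using hu₀
  replace hu₁ : ∀ t : ℝ, 0 < t → eLpNorm (u t) (ENNReal.ofReal q₁) volume ≤
      ENNReal.ofReal (C * t ^ (-((n : ℝ) / p - n / q₁))) := by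
    simpa only [neg_sub] using hu₁
  have hIoc {a b : ℝ} (ha : 0 ≤ a) : Set.Ioc a b ⊆ Set.Ioi 0 := fun t ht => ha.trans_lt ht.1
  constructor
  · have hR := lintegral_setLIntegral_rpow_le (d := (n : ℝ) / q₀ - n / q) (by linarith) hu hu₀
      (measurableSet_Ioc (a := 0) (b := R)) (hIoc le_rfl)
    rw [setLIntegral_Ioc_rpow_sub_one (hε.trans hεR) hd₀] at hR
    have hfin := ae_lt_top ((measurable_setLIntegral_rpow_mul_enorm hu _ _).pow_const q₀)
      (hR.trans_lt (ENNReal.rpow_lt_top_of_nonneg hq₀0.le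
        (ENNReal.mul_ne_top ENNReal.ofReal_ne_top ENNReal.ofReal_ne_top))).ne
    filter_upwards [hfin] with x hx
    rw [← hexp, ENNReal.rpow_lt_top_iff_of_pos hq₀0] at hx
    refine ⟨?_, ?_⟩
    · have hpow : Measurable fun t : ℝ => (t : ℂ) ^ (α - 1) := by fun_prop
      exact hpow.aestronglyMeasurable.smul
        (hu.comp_measurable measurable_prodMk_right).aestronglyMeasurable
    · rw [hasFiniteIntegral_iff_enorm,
        setLIntegral_enorm_cpow_smul α (u · x) measurableSet_Ioc (hIoc hε.le)]
      exact (lintegral_mono_set (Set.Ioc_subset_Ioc_left hε.le)).trans_lt hx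
  · intro lam hlam
    have hτ : 0 < lam ^ (-q / n) := by positivity
    have h₀ := measure_setLIntegral_ge_le (by linarith) hC hq0 hn0 hd₀.ne' rfl hu hu₀
      measurableSet_Ioc (hIoc le_rfl) hlam
      (by rw [setLIntegral_Ioc_rpow_sub_one hτ hd₀, abs_of_pos hd₀])
    have h₁ := measure_setLIntegral_ge_le (by linarith) hC hq0 hn0 hd₁.ne rfl hu hu₁
      measurableSet_Ioi (Set.Ioi_subset_Ioi hτ.le) hlam
      (by rw [setLIntegral_Ioi_rpow_sub_one hτ hd₁, abs_of_neg hd₁])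
    rw [← hexp] at h₀ h₁
    rw [add_mul, ENNReal.ofReal_add (by positivity) (by positivity)]
    refine (measure_mono fun x hx => ?_).trans ((measure_union_le _ _).trans (add_le_add h₀ h₁))
    have hsplit : ENNReal.ofReal lam <
        (∫⁻ t in Set.Ioc 0 (lam ^ (-q / n)), ENNReal.ofReal (t ^ (α.re - 1)) * ‖u t x‖ₑ) +
          ∫⁻ t in Set.Ioi (lam ^ (-q / n)), ENNReal.ofReal (t ^ (α.re - 1)) * ‖u t x‖ₑ := by
      calc ENNReal.ofReal lam < ‖∫ t in Set.Ioc ε R, ((t : ℂ) ^ (α - 1)) • u t x‖ₑ := by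
            rw [← ofReal_norm]
            exact (ENNReal.ofReal_lt_ofReal_iff_of_nonneg hlam.le).2 hx
        _ ≤ ∫⁻ t in Set.Ioc ε R, ‖((t : ℂ) ^ (α - 1)) • u t x‖ₑ :=
            enorm_integral_le_lintegral_enorm _
        _ = ∫⁻ t in Set.Ioc ε R, ENNReal.ofReal (t ^ (α.re - 1)) * ‖u t x‖ₑ :=
            setLIntegral_enorm_cpow_smul α (u · x) measurableSet_Ioc (hIoc hε.le)
        _ ≤ ∫⁻ t in Set.Ioc 0 (lam ^ (-q / n)) ∪ Set.Ioi (lam ^ (-q / n)),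
              ENNReal.ofReal (t ^ (α.re - 1)) * ‖u t x‖ₑ := by
            rw [Set.Ioc_union_Ioi_eq_Ioi hτ.le]
            exact lintegral_mono_set (hIoc hε.le)
        _ ≤ _ := lintegral_union_le _ _ _
    by_contra hcon
    simp only [Set.mem_union, Set.mem_ofPred_eq, not_or, not_le] at hcon
    refine (hsplit.trans (ENNReal.add_lt_add hcon.1 hcon.2)).ne ?_
    rw [← ENNReal.ofReal_add (by positivity) (by positivity), add_halves]
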